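/- Let v_1, v_2 : ℝ → ℝ be continuous functions, let r > 0, let F be a 3×3 real orthogonal matrix, and let q : ℝ → M_3(ℝ) be differentiable with q(0) = I and q'(t) = q(t)·Ω(t) for all t, where Ω(t) is the skew-symmetric matrix (1/r)·[[0, 0, v_1(t)], [0, 0, v_2(t)], [−v_1(t), −v_2(t), 0]]. Then q(t) is orthogonal (q(t)ᵀ·q(t) = I) for every t, and the curve γ(t) := F·q(t)·(0, 0, r)ᵀ satisfies ‖γ(t)‖ = r and γ'(t) = v_1(t)·F·q(t)·e_1 + v_2(t)·F·q(t)·e_2 for all t, where e_1, e_2 are the first two standard basis vectors of ℝ^3. -/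

import Mathlib

open Matrix

attribute [local instance] Matrix.normedAddCommGroup Matrix.normedSpace

/-- A matrix-valued curve is differentiable iff its entries are. -/
theorem Matrix.hasDerivAt_iff {m n : Type*} [Fintype m] [Fintype n]
    {q : ℝ → Matrix m n ℝ} {q' : Matrix m n ℝ} {t : ℝ} :
    HasDerivAt q q' t ↔ ∀ i j, HasDerivAt (fun s => q s i j) (q' i j) t :=
  hasDerivAt_pi.trans (forall_congr' fun _ => hasDerivAt_pi)

/-- The solution of `q' = q * Ω` with `Ω` skew-symmetric stays orthogonal. -/
theorem Matrix.transpose_mul_self_eq_one_of_hasDerivAt {n : Type*} [Fintype n] [DecidableEq n]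
    {q Ω : ℝ → Matrix n n ℝ} (hΩ : ∀ t, (Ω t)ᵀ = -Ω t) (hq0 : q 0 = 1)
    (hq : ∀ t, HasDerivAt q (q t * Ω t) t) (t : ℝ) : (q t)ᵀ * q t = 1 := by
  rw [mul_eq_one_comm]
  have hderiv (i j : n) (s : ℝ) : HasDerivAt (fun s => (q s * (q s)ᵀ) i j) 0 s := by
    have hentry := Matrix.hasDerivAt_iff.1 (hq s)
    have hsum : HasDerivAt (fun s => (q s * (q s)ᵀ) i j)
        ((q s * Ω s * (q s)ᵀ + q s * (q s * Ω s)ᵀ) i j) s := by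
      simp only [Matrix.add_apply, mul_apply (M := q s * Ω s), mul_apply (N := (q s * Ω s)ᵀ),
        mul_apply (N := (q _)ᵀ), transpose_apply, ← Finset.sum_add_distrib]
      exact HasDerivAt.fun_sum fun k _ => (hentry i k).mul (hentry j k)
    simpa [transpose_mul, hΩ, Matrix.mul_assoc] using hsum
  ext i j
  have hconst := is_const_of_deriv_eq_zero (fun s => (hderiv i j s).differentiableAt)
    (fun s => (hderiv i j s).deriv) t 0
  simpa [hq0] using hconst

/-- Applying a differentiable matrix-valued curve to a constant vector. -/
theorem HasDerivAt.const_mul_mulVec {l m n : Type*} [Fintype l] [Fintype m] [Fintype n]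
    {q : ℝ → Matrix m n ℝ} {q' : Matrix m n ℝ} {t : ℝ} (hq : HasDerivAt q q' t)
    (F : Matrix l m ℝ) (w : n → ℝ) :
    HasDerivAt (fun s => (F * q s) *ᵥ w) ((F * q') *ᵥ w) t := by
  refine hasDerivAt_pi.2 fun i => ?_
  simp only [mulVec, dotProduct, mul_apply]
  exact HasDerivAt.fun_sum fun k _ => (HasDerivAt.fun_sum fun j _ =>
    (Matrix.hasDerivAt_iff.1 hq j k).const_mul (F i j)).mul_const (w k)

/-- Integration of most probable paths on the sphere of radius `r` in `SO(3)`: if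
`q' = q·Ω` with `Ω` the skew-symmetric matrix built from `v₁, v₂`, `q(0) = 1`, and `F` is
orthogonal, then `q(t)` stays orthogonal, and `γ(t) = F·q(t)·(0,0,r)ᵀ` satisfies `‖γ(t)‖ = r`
and `γ' = v₁·F·q·e₁ + v₂·F·q·e₂`. -/
theorem stmt15 (v1 v2 : ℝ → ℝ) (hv1 : Continuous v1) (hv2 : Continuous v2)
    (r : ℝ) (hr : 0 < r) (F : Matrix (Fin 3) (Fin 3) ℝ) (hF : Fᵀ * F = 1)
    (q : ℝ → Matrix (Fin 3) (Fin 3) ℝ) (hq0 : q 0 = 1)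
    (hq : ∀ t, HasDerivAt q
      (q t * ((1 / r) • !![0, 0, v1 t; 0, 0, v2 t; -v1 t, -v2 t, 0])) t) :
    let γ : ℝ → Fin 3 → ℝ := fun t => (F * q t).mulVec ![0, 0, r]
    (∀ t, (q t)ᵀ * q t = 1) ∧
    (∀ t, Real.sqrt (γ t ⬝ᵥ γ t) = r) ∧
    (∀ t, HasDerivAt γ
      (v1 t • (F * q t).mulVec ![1, 0, 0] + v2 t • (F * q t).mulVec ![0, 1, 0]) t) := by
  have horth := Matrix.transpose_mul_self_eq_one_of_hasDerivAt (q := q) (fun t => by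
    ext i j
    fin_cases i <;> fin_cases j <;> simp) hq0 hq
  refine ⟨horth, fun t => ?_, fun t => ?_⟩
  · have hFq : (F * q t)ᵀ * (F * q t) = 1 := by
      rw [transpose_mul, Matrix.mul_assoc, ← Matrix.mul_assoc Fᵀ, hF, Matrix.one_mul, horth]
    have hγ : ((F * q t) *ᵥ ![0, 0, r]) ⬝ᵥ ((F * q t) *ᵥ ![0, 0, r]) = r ^ 2 := by
      rw [dotProduct_mulVec, vecMul_mulVec, ← mulVec_transpose, transpose_mul,
        transpose_transpose, hFq]
      simp [dotProduct, Fin.sum_univ_three, sq]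
    change √(((F * q t) *ᵥ ![0, 0, r]) ⬝ᵥ ((F * q t) *ᵥ ![0, 0, r])) = r
    rw [hγ, Real.sqrt_sq hr.le]
  · convert (hq t).const_mul_mulVec F ![0, 0, r] using 1
    rw [← Matrix.mul_assoc, ← mulVec_mulVec _ (F * q t), ← mulVec_smul, ← mulVec_smul, ← mulVec_add]
    congr 1
    ext i
    fin_cases i <;> simp [mulVec, dotProduct, Fin.sum_univ_three] <;> field_simp
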